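/- arXiv:1901.08895 — 2 statements merged into one kernel-verified Lean document; each statement's English description precedes it below -/
import Mathlib

section
/- For every integer n ≥ 1, the group of all isometries of the Euclidean space ℝⁿ (surjective self-isometries of ℝⁿ with the Euclidean distance) is fixating if and only if n ≤ 3. -/
open Module
open scoped Quaternion

/-- Every group of self-isometries of `E` all of whose elements have a fixed point has a common
fixed point. -/
def IsometryFixating (E : Type*) [PseudoEMetricSpace E] : Prop :=
  ∀ G : Subgroup (E ≃ᵢ E), (∀ g ∈ G, ∃ x, g x = x) → ∃ x, ∀ g ∈ G, g x = x

/-- The underlying permutation of a self-isometry, as a group homomorphism. -/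
def isometryToPerm (E : Type*) [PseudoEMetricSpace E] : (E ≃ᵢ E) →* Equiv.Perm E where
  toFun g := g.toEquiv
  map_one' := rfl
  map_mul' _ _ := rfl

theorem isometryFixating_iff_perm (E : Type*) [PseudoMetricSpace E] :
    IsometryFixating E ↔ ∀ G : Subgroup (Equiv.Perm E),
      (∀ g ∈ G, ∀ x y : E, dist (g x) (g y) = dist x y) →
      (∀ g ∈ G, ∃ x : E, g x = x) → ∃ x : E, ∀ g ∈ G, g x = x := by
  constructor
  · intro h G hiso hfix
    obtain ⟨x, hx⟩ := h (G.comap (isometryToPerm E)) fun g hg => hfix _ hg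
    exact ⟨x, fun g hg => hx ⟨g, Isometry.of_dist_eq (hiso g hg)⟩ hg⟩
  · intro h G hfix
    obtain ⟨x, hx⟩ := h (G.map (isometryToPerm E))
      (by rintro _ ⟨g, -, rfl⟩ x y; exact g.isometry.dist_eq x y)
      (by rintro _ ⟨g, hg, rfl⟩; exact hfix g hg)
    exact ⟨x, fun g hg => hx _ ⟨g, hg, rfl⟩⟩

/-- Let a self-isometry of `V` act on the first factor of the Euclidean product `V × U`. -/
def isometryProdHom (V U : Type*) [NormedAddCommGroup V] [NormedAddCommGroup U] :
    (V ≃ᵢ V) →* (WithLp 2 (V × U) ≃ᵢ WithLp 2 (V × U)) where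
  toFun g :=
    { toFun := fun z => WithLp.toLp 2 (g z.fst, z.snd)
      invFun := fun z => WithLp.toLp 2 (g.symm z.fst, z.snd)
      left_inv := fun z => by cases z; simp
      right_inv := fun z => by cases z; simp
      isometry_toFun := Isometry.of_dist_eq fun z w => by
        simp [WithLp.prod_dist_eq_of_L2, g.isometry.dist_eq] }
  map_one' := rfl
  map_mul' _ _ := rfl

theorem IsometryFixating.of_prod {V U : Type*} [NormedAddCommGroup V] [NormedAddCommGroup U]
    (h : IsometryFixating (WithLp 2 (V × U))) : IsometryFixating V := by
  intro G hG
  obtain ⟨z, hz⟩ := h (G.map (isometryProdHom V U)) (by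
    rintro _ ⟨g, hg, rfl⟩
    obtain ⟨x, hx⟩ := hG g hg
    exact ⟨WithLp.toLp 2 (x, 0), congrArg (fun y => WithLp.toLp 2 (y, (0 : U))) hx⟩)
  exact ⟨z.fst, fun g hg => congrArg WithLp.fst (hz _ ⟨g, hg, rfl⟩)⟩

/-- Conjugation by an isometry, as a group homomorphism. -/
def isometryConjHom {E F : Type*} [PseudoEMetricSpace E] [PseudoEMetricSpace F] (e : E ≃ᵢ F) :
    (F ≃ᵢ F) →* (E ≃ᵢ E) where
  toFun g := (e.trans g).trans e.symm
  map_one' := by ext; simp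
  map_mul' _ _ := by ext; simp

theorem IsometryFixating.of_isometryEquiv {E F : Type*} [PseudoEMetricSpace E]
    [PseudoEMetricSpace F] (e : E ≃ᵢ F) (h : IsometryFixating E) : IsometryFixating F := by
  intro G hG
  obtain ⟨x, hx⟩ := h (G.map (isometryConjHom e)) (by
    rintro _ ⟨g, hg, rfl⟩
    obtain ⟨y, hy⟩ := hG g hg
    exact ⟨e.symm y, by simp [isometryConjHom, hy]⟩)
  refine ⟨e x, fun g hg => ?_⟩
  have := hx _ ⟨g, hg, rfl⟩
  simpa [isometryConjHom, IsometryEquiv.symm_apply_eq] using this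

theorem IsometryFixating.of_finrank_le {V W : Type*} [NormedAddCommGroup V]
    [InnerProductSpace ℝ V] [FiniteDimensional ℝ V] [NormedAddCommGroup W]
    [InnerProductSpace ℝ W] [FiniteDimensional ℝ W] (hVW : finrank ℝ V ≤ finrank ℝ W)
    (h : IsometryFixating W) : IsometryFixating V := by
  let U := EuclideanSpace ℝ (Fin (finrank ℝ W - finrank ℝ V))
  have hd : finrank ℝ W = finrank ℝ (WithLp 2 (V × U)) := by
    rw [(WithLp.linearEquiv 2 ℝ (V × U)).finrank_eq, finrank_prod, finrank_euclideanSpace_fin]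
    omega
  refine IsometryFixating.of_prod (U := U) (h.of_isometryEquiv ?_)
  exact ((stdOrthonormalBasis ℝ W).equiv (stdOrthonormalBasis ℝ (WithLp 2 (V × U)))
    (finCongr hd)).toIsometryEquiv

/-- The self-isometry `x ↦ u * (x - p) + p` of the quaternions, for `u` of norm one. -/
noncomputable def quaternionRotation (u p : ℍ[ℝ]) (hu : ‖u‖ = 1) : ℍ[ℝ] ≃ᵢ ℍ[ℝ] where
  toFun x := u * (x - p) + p
  invFun x := u⁻¹ * (x - p) + p
  left_inv x := by
    have : u ≠ 0 := by rintro rfl; simp at hu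
    simp [inv_mul_cancel_left₀ this]
  right_inv x := by
    have : u ≠ 0 := by rintro rfl; simp at hu
    simp [mul_inv_cancel_left₀ this]
  isometry_toFun := Isometry.of_dist_eq fun x y => by
    simp [dist_eq_norm, ← mul_sub, hu]

/-- The integral quaternions `3 ± 4i` and `3 ± 4j`. -/
def letterQuaternion (s : Bool × Bool) : ℍ[ℤ] :=
  ⟨3, bif s.1 then bif s.2 then 4 else -4 else 0, bif s.1 then 0 else bif s.2 then 4 else -4, 0⟩

@[simp] theorem letterQuaternion_re (s : Bool × Bool) : (letterQuaternion s).re = 3 := rfl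

@[simp] theorem letterQuaternion_imI (s : Bool × Bool) :
    (letterQuaternion s).imI = bif s.1 then bif s.2 then 4 else -4 else 0 := rfl

@[simp] theorem letterQuaternion_imJ (s : Bool × Bool) :
    (letterQuaternion s).imJ = bif s.1 then 0 else bif s.2 then 4 else -4 := rfl

@[simp] theorem letterQuaternion_imK (s : Bool × Bool) : (letterQuaternion s).imK = 0 := rfl

/-- All coordinates of the integral quaternion are divisible by `5`. -/
def FiveDvd (q : ℍ[ℤ]) : Prop := 5 ∣ q.re ∧ 5 ∣ q.imI ∧ 5 ∣ q.imJ ∧ 5 ∣ q.imK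

theorem fiveDvd_letter_sq_mul_sub (s : Bool × Bool) (q : ℍ[ℤ]) :
    FiveDvd (letterQuaternion s * (letterQuaternion s * q) - letterQuaternion s * q) := by
  obtain ⟨_ | _, _ | _⟩ := s <;> simp [FiveDvd] <;> omega

theorem not_fiveDvd_letter_mul {s t : Bool × Bool} (hst : t.1 = s.1 → t.2 = s.2) {q : ℍ[ℤ]}
    (hs : FiveDvd (letterQuaternion s * q - q)) (hq : ¬ FiveDvd q) :
    ¬ FiveDvd (letterQuaternion t * q) := by
  contrapose! hq
  obtain ⟨_ | _, _ | _⟩ := s <;> obtain ⟨_ | _, _ | _⟩ := t <;>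
    simp [FiveDvd] at * <;> omega

theorem not_fiveDvd_prod_of_isReduced {s : Bool × Bool} {L : List (Bool × Bool)}
    (h : FreeGroup.IsReduced (s :: L)) :
    FiveDvd (letterQuaternion s * ((s :: L).map letterQuaternion).prod -
        ((s :: L).map letterQuaternion).prod) ∧
      ¬ FiveDvd ((s :: L).map letterQuaternion).prod := by
  induction L generalizing s with
  | nil =>
    rw [List.map_cons, List.map_nil, List.prod_cons, List.prod_nil]
    refine ⟨fiveDvd_letter_sq_mul_sub s 1, ?_⟩
    obtain ⟨_ | _, _ | _⟩ := s <;> simp [FiveDvd]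
  | cons t L ih =>
    rw [FreeGroup.isReduced_cons_cons] at h
    obtain ⟨h₁, h₂⟩ := ih h.2
    rw [List.map_cons, List.prod_cons]
    exact ⟨fiveDvd_letter_sq_mul_sub s _, not_fiveDvd_letter_mul h.1 h₁ h₂⟩

/-- The real quaternion with the coordinates of an integral one. -/
def realQuaternion (q : ℍ[ℤ]) : ℍ[ℝ] := ⟨q.re, q.imI, q.imJ, q.imK⟩

@[simp] theorem realQuaternion_re (q : ℍ[ℤ]) : (realQuaternion q).re = q.re := rfl

@[simp] theorem realQuaternion_imI (q : ℍ[ℤ]) : (realQuaternion q).imI = q.imI := rfl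

@[simp] theorem realQuaternion_imJ (q : ℍ[ℤ]) : (realQuaternion q).imJ = q.imJ := rfl

@[simp] theorem realQuaternion_imK (q : ℍ[ℤ]) : (realQuaternion q).imK = q.imK := rfl

theorem realQuaternion_one : realQuaternion 1 = 1 := by
  ext <;> simp

theorem realQuaternion_mul (p q : ℍ[ℤ]) :
    realQuaternion (p * q) = realQuaternion p * realQuaternion q := by
  ext <;> simp

/-- The unit quaternions `(3 ± 4i) / 5` and `(3 ± 4j) / 5`. -/
noncomputable def freeQuaternion (s : Bool × Bool) : ℍ[ℝ] :=
  (5⁻¹ : ℝ) • realQuaternion (letterQuaternion s)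

theorem norm_freeQuaternion (s : Bool × Bool) : ‖freeQuaternion s‖ = 1 := by
  have h : ‖freeQuaternion s‖ * ‖freeQuaternion s‖ = 1 := by
    rw [← Quaternion.normSq_eq_norm_mul_self, Quaternion.normSq_def']
    obtain ⟨_ | _, _ | _⟩ := s <;> norm_num [freeQuaternion]
  nlinarith [norm_nonneg (freeQuaternion s)]

theorem inv_freeQuaternion (b : Bool) :
    (freeQuaternion (b, true))⁻¹ = freeQuaternion (b, false) := by
  refine inv_eq_of_mul_eq_one_right ?_
  cases b <;> ext <;> simp [freeQuaternion] <;> norm_num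

theorem eq_zero_of_freeQuaternion_mul_eq (s : Bool × Bool) (z : ℍ[ℝ])
    (h : freeQuaternion s * z = z) : z = 0 := by
  have h₁ : (freeQuaternion s - 1) * z = 0 := by rw [sub_mul, h, one_mul, sub_self]
  refine (mul_eq_zero.1 h₁).resolve_left fun h₂ => ?_
  have := congrArg (fun q : ℍ[ℝ] => q.re) h₂
  norm_num [freeQuaternion] at this

/-- The free rotations of the quaternions with linear parts `(3 + 4i) / 5` and `(3 + 4j) / 5`,
and with fixed points `0` and `1`. -/
noncomputable def freeRotations : FreeGroup Bool →* (ℍ[ℝ] ≃ᵢ ℍ[ℝ]) :=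
  FreeGroup.lift fun b =>
    quaternionRotation (freeQuaternion (b, true)) (bif b then 0 else 1) (norm_freeQuaternion _)

theorem freeRotations_mk_sub (L : List (Bool × Bool)) (x y : ℍ[ℝ]) :
    ((5 ^ L.length : ℝ) : ℍ[ℝ]) *
        (freeRotations (FreeGroup.mk L) x - freeRotations (FreeGroup.mk L) y) =
      realQuaternion (L.map letterQuaternion).prod * (x - y) := by
  induction L with
  | nil => simp [freeRotations, realQuaternion_one]
  | cons s L ih =>
    have hs (x y : ℍ[ℝ]) : freeRotations (FreeGroup.mk [s]) x - freeRotations (FreeGroup.mk [s]) y =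
        freeQuaternion s * (x - y) := by
      obtain ⟨b, _ | _⟩ := s
      · have hinv : freeRotations (FreeGroup.mk [(b, false)]) =
            (quaternionRotation (freeQuaternion (b, true)) (bif b then 0 else 1)
              (norm_freeQuaternion _)).symm := by
          simp [freeRotations, FreeGroup.lift_mk]
          rfl
        rw [hinv, ← inv_freeQuaternion]
        simp [quaternionRotation, IsometryEquiv.symm, mul_sub]
      · simp [freeRotations, FreeGroup.lift_mk, quaternionRotation, mul_sub]
    have hmk : FreeGroup.mk (s :: L) = FreeGroup.mk [s] * FreeGroup.mk L := by simp
    rw [hmk, map_mul, IsometryEquiv.mul_apply, IsometryEquiv.mul_apply, hs, List.map_cons,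
      List.prod_cons, realQuaternion_mul, mul_assoc, ← ih, List.length_cons, pow_succ,
      freeQuaternion]
    simp only [Quaternion.coe_mul_eq_smul, mul_smul_comm, smul_mul_assoc, smul_smul]
    congr 1
    ring

theorem exists_freeRotations_eq_self (w : FreeGroup Bool) : ∃ x, freeRotations w x = x := by
  by_cases hw : w = 1
  · exact ⟨0, by simp [hw]⟩
  obtain ⟨s, L, hL⟩ := List.exists_cons_of_ne_nil (mt FreeGroup.toWord_eq_nil_iff.1 hw)
  have hred := FreeGroup.isReduced_toWord (x := w)
  have hmul := freeRotations_mk_sub w.toWord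
  rw [FreeGroup.mk_toWord] at hmul
  rw [hL] at hred hmul
  set q := ((s :: L).map letterQuaternion).prod with hqdef
  set c : ℍ[ℝ] := ((5 ^ (s :: L).length : ℝ) : ℍ[ℝ]) with hc
  have hc0 : c ≠ 0 := by
    rw [hc, Ne, ← Quaternion.coe_zero, Quaternion.coe_inj]
    positivity
  have hq : c - realQuaternion q ≠ 0 := by
    intro h0
    apply (not_fiveDvd_prod_of_isReduced hred).2
    rw [← hqdef]
    rw [sub_eq_zero, Quaternion.ext_iff] at h0
    simp only [hc, Quaternion.re_coe, Quaternion.imI_coe, Quaternion.imJ_coe, Quaternion.imK_coe,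
      realQuaternion_re, realQuaternion_imI, realQuaternion_imJ, realQuaternion_imK] at h0
    obtain ⟨h₁, h₂, h₃, h₄⟩ := h0
    norm_cast at h₁ h₂ h₃ h₄
    refine ⟨?_, ?_, ?_, ?_⟩
    · rw [← h₁, List.length_cons, pow_succ]
      push_cast
      exact dvd_mul_left _ _
    · simp [← h₂]
    · simp [← h₃]
    · simp [← h₄]
  refine ⟨(c - realQuaternion q)⁻¹ * (c * freeRotations w 0), ?_⟩
  set x := (c - realQuaternion q)⁻¹ * (c * freeRotations w 0) with hx
  have h₁ : (c - realQuaternion q) * x = c * freeRotations w 0 := by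
    rw [hx, mul_inv_cancel_left₀ hq]
  have h₂ := hmul x 0
  rw [mul_sub, sub_zero, ← h₁, sub_mul] at h₂
  refine mul_left_cancel₀ hc0 ?_
  rw [sub_eq_iff_eq_add.1 h₂]
  abel

theorem not_isometryFixating_quaternion : ¬ IsometryFixating ℍ[ℝ] := by
  intro h
  obtain ⟨x, hx⟩ := h freeRotations.range (by
    rintro _ ⟨w, rfl⟩
    exact exists_freeRotations_eq_self w)
  have key (b : Bool) : x = bif b then 0 else 1 := by
    have h₁ := hx _ ⟨FreeGroup.of b, rfl⟩
    rw [freeRotations, FreeGroup.lift_apply_of] at h₁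
    exact sub_eq_zero.1 (eq_zero_of_freeQuaternion_mul_eq (b, true) _ (eq_sub_of_add_eq h₁))
  exact zero_ne_one ((key true).symm.trans (key false))

section Rotations

variable {E : Type*} [NormedAddCommGroup E] [InnerProductSpace ℝ E]

/-- The determinant of a linear isometry, as a monoid homomorphism. -/
noncomputable def isometryDet (E : Type*) [NormedAddCommGroup E] [InnerProductSpace ℝ E] :
    (E ≃ₗᵢ[ℝ] E) →* ℝ where
  toFun φ := LinearMap.det φ.toLinearMap
  map_one' := LinearMap.det_id
  map_mul' φ ψ := LinearMap.det_comp φ.toLinearMap ψ.toLinearMap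

/-- The linear part of a self-isometry, as a group homomorphism. -/
noncomputable def linearPart (E : Type*) [NormedAddCommGroup E] [InnerProductSpace ℝ E] :
    (E ≃ᵢ E) →* (E ≃ₗᵢ[ℝ] E) where
  toFun g := g.toRealAffineIsometryEquiv.linearIsometryEquiv
  map_one' := by
    ext v
    have := (1 : E ≃ᵢ E).toRealAffineIsometryEquiv.map_vsub v 0
    simpa using this
  map_mul' g h := by
    ext v
    have h₁ := (g * h).toRealAffineIsometryEquiv.map_vsub v 0
    have h₂ := h.toRealAffineIsometryEquiv.map_vsub v 0
    have h₃ := g.toRealAffineIsometryEquiv.map_vsub (h v) (h 0)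
    simp only [vsub_eq_sub, sub_zero, IsometryEquiv.coeFn_toRealAffineIsometryEquiv,
      IsometryEquiv.mul_apply] at h₁ h₂ h₃
    rw [LinearIsometryEquiv.coe_mul, Function.comp_apply, h₁, h₂, h₃]

theorem linearPart_sub (g : E ≃ᵢ E) (x y : E) : linearPart E g (x - y) = g x - g y :=
  g.toRealAffineIsometryEquiv.map_vsub x y

theorem eq_one_of_linearPart_eq_one {g : E ≃ᵢ E} (hg : linearPart E g = 1) {x : E}
    (hx : g x = x) : g = 1 := by
  ext y
  have := linearPart_sub g y x
  rw [hg, hx, LinearIsometryEquiv.coe_one, id] at this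
  exact (sub_left_inj.1 this).symm

theorem linearPart_sub_of_fixed {g : E ≃ᵢ E} {x y : E} (hx : g x = x) (hy : g y = y) :
    linearPart E g (x - y) = x - y := by
  rw [linearPart_sub, hx, hy]

theorem fixed_add_of_linearPart {g : E ≃ᵢ E} {x v : E} (hx : g x = x)
    (hv : linearPart E g v = v) : g (x + v) = x + v := by
  have := linearPart_sub g (x + v) x
  rw [add_sub_cancel_left, hv, hx] at this
  rw [eq_add_of_sub_eq this.symm, add_comm]

theorem inner_axis_eq_zero {R S : E ≃ₗᵢ[ℝ] E} {u v w : E} (hu : R u = u) (hv : S v = v)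
    (hw : R (S w) = w) : inner ℝ u (S w - w) = 0 ∧ inner ℝ v (S w - w) = 0 := by
  constructor
  · have := R.inner_map_map u (S w)
    rw [hu, hw] at this
    rw [inner_sub_right, this, sub_self]
  · have := S.inner_map_map v w
    rw [hv] at this
    rw [inner_sub_right, this, sub_self]

variable [FiniteDimensional ℝ E]

theorem isometryDet_reflection {v : E} (hv : v ≠ 0) :
    isometryDet E (ℝ ∙ v)ᗮ.reflection = -1 := by
  refine ((ℝ ∙ v)ᗮ.det_reflection).trans ?_
  rw [Submodule.orthogonal_orthogonal, finrank_span_singleton hv, pow_one]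

theorem exists_reflections_isometryDet {n : ℕ} (φ : E ≃ₗᵢ[ℝ] E)
    (hn : finrank ℝ (ContinuousLinearMap.id ℝ E - φ).kerᗮ ≤ n) :
    ∃ l : List E, l.length ≤ n ∧ φ = (l.map fun v => (ℝ ∙ v)ᗮ.reflection).prod ∧
      isometryDet E φ = (-1) ^ l.length := by
  obtain ⟨l, hl, rfl⟩ := φ.reflections_generate_dim_aux hn
  clear hn
  induction l generalizing n with
  | nil => exact ⟨[], hl, rfl, by simp⟩
  | cons v l ih =>
    obtain ⟨l', hl', h, hd⟩ := ih le_rfl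
    rw [List.length_cons] at hl
    by_cases hv : v = 0
    · have hone : (ℝ ∙ v)ᗮ.reflection = 1 := by
        ext x
        exact Submodule.reflection_mem_subspace_eq_self (by simp [hv])
      rw [List.map_cons, List.prod_cons, hone, one_mul]
      exact ⟨l', by omega, h, hd⟩
    · refine ⟨v :: l', by simp; omega, by simp [h], ?_⟩
      rw [List.map_cons, List.prod_cons, map_mul, hd, isometryDet_reflection hv, List.length_cons,
        pow_succ']

theorem isometryDet_eq_or (φ : E ≃ₗᵢ[ℝ] E) : isometryDet E φ = 1 ∨ isometryDet E φ = -1 := by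
  obtain ⟨l, -, -, h⟩ := exists_reflections_isometryDet φ le_rfl
  rw [h]
  exact neg_one_pow_eq_or ℝ _

theorem finrank_fixed_orthogonal_add_le {k : ℕ} {φ : E ≃ₗᵢ[ℝ] E} {b : Fin k → E}
    (hb : LinearIndependent ℝ b) (hφ : ∀ i, φ (b i) = b i) :
    finrank ℝ (ContinuousLinearMap.id ℝ E - φ).kerᗮ + k ≤ finrank ℝ E := by
  set K := (ContinuousLinearMap.id ℝ E - (φ : E →L[ℝ] E)).ker
  have h₁ : Submodule.span ℝ (Set.range b) ≤ K := by
    rw [Submodule.span_le]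
    rintro _ ⟨i, rfl⟩
    simp [K, hφ i]
  have h₂ := Submodule.finrank_mono h₁
  rw [finrank_span_eq_card hb, Fintype.card_fin] at h₂
  have h₃ := K.finrank_add_finrank_orthogonal
  omega

theorem eq_one_of_fixed_pair (hE : finrank ℝ E = 3)
    {φ : E ≃ₗᵢ[ℝ] E} (hd : isometryDet E φ = 1) {u v : E}
    (huv : LinearIndependent ℝ ![u, v]) (hu : φ u = u) (hv : φ v = v) : φ = 1 := by
  have h := finrank_fixed_orthogonal_add_le (φ := φ) huv (by simp [Fin.forall_fin_two, hu, hv])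
  obtain ⟨l, hl, h₁, h₂⟩ := exists_reflections_isometryDet (n := 1) φ (by omega)
  rw [hd] at h₂
  match l, hl with
  | [], _ => simpa using h₁
  | [a], _ => norm_num at h₂

theorem mul_self_eq_one_of_det_eq_neg_one (hE : finrank ℝ E = 3)
    {φ : E ≃ₗᵢ[ℝ] E} (hd : isometryDet E φ = -1) {u : E}
    (hu0 : u ≠ 0) (hu : φ u = u) : φ * φ = 1 := by
  have h := finrank_fixed_orthogonal_add_le (φ := φ) (b := ![u])
    (by simpa [linearIndependent_unique_iff] using hu0) (by simp [hu])
  obtain ⟨l, hl, h₁, h₂⟩ := exists_reflections_isometryDet (n := 2) φ (by omega)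
  rw [hd] at h₂
  match l, hl with
  | [], _ => norm_num at h₂
  | [a], _ =>
    rw [h₁]
    simp [Submodule.reflection_mul_reflection]
  | [a, b], _ => norm_num at h₂

theorem exists_ne_zero_inner_eq_zero (hE : finrank ℝ E = 3) (a b : E) :
    ∃ x : E, x ≠ 0 ∧ inner ℝ a x = 0 ∧ inner ℝ b x = 0 := by
  have h : finrank ℝ (Submodule.span ℝ {a, b}) ≤ 2 := by
    classical
    have := finrank_span_finset_le_card (R := ℝ) ({a, b} : Finset E)
    have h₂ := Finset.card_le_two (a := a) (b := b)
    simp only [Finset.coe_insert, Finset.coe_singleton] at this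
    exact this.trans h₂
  have h₁ := (Submodule.span ℝ {a, b}).finrank_add_finrank_orthogonal
  have h₂ : (Submodule.span ℝ {a, b})ᗮ ≠ ⊥ := by
    intro h₀
    rw [h₀, finrank_bot] at h₁
    omega
  obtain ⟨x, hx, hx0⟩ := Submodule.exists_mem_ne_zero_of_ne_bot h₂
  rw [Submodule.mem_orthogonal] at hx
  exact ⟨x, hx0, hx a (Submodule.subset_span (by simp)), hx b (Submodule.subset_span (by simp))⟩

theorem exists_axis (hE : finrank ℝ E = 3)
    {φ : E ≃ₗᵢ[ℝ] E} (hd : isometryDet E φ = 1) : ∃ u : E, u ≠ 0 ∧ φ u = u := by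
  have h := finrank_fixed_orthogonal_add_le (φ := φ) (b := ![]) linearIndependent_empty_type
    (by simp)
  obtain ⟨l, hl, h₁, h₂⟩ := exists_reflections_isometryDet (n := 3) φ (by omega)
  rw [hd] at h₂
  match l, hl with
  | [], _ =>
    obtain ⟨x, hx, -⟩ := exists_ne_zero_inner_eq_zero hE 0 0
    exact ⟨x, hx, by simp [h₁]⟩
  | [a], _ => norm_num at h₂
  | [a, b], _ =>
    obtain ⟨x, hx, ha, hb⟩ := exists_ne_zero_inner_eq_zero hE a b
    refine ⟨x, hx, ?_⟩
    have hr {c : E} (hc : inner ℝ c x = 0) : (ℝ ∙ c)ᗮ.reflection x = x :=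
      Submodule.reflection_mem_subspace_eq_self
        (Submodule.mem_orthogonal_singleton_iff_inner_right.2 hc)
    simp [h₁, hr ha, hr hb]
  | [a, b, c], _ => norm_num at h₂

theorem commute_of_common_axis (hE : finrank ℝ E = 3) {R S : E ≃ₗᵢ[ℝ] E} (hR : isometryDet E R = 1)
    (hS : isometryDet E S = 1) {u : E} (hu0 : u ≠ 0) (hRu : R u = u) (hSu : S u = u) :
    R * S = S * R := by
  obtain ⟨v, hv0, hv, -⟩ := exists_ne_zero_inner_eq_zero hE u 0
  set T := (ℝ ∙ v)ᗮ.reflection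
  have hT : isometryDet E T = -1 := isometryDet_reflection hv0
  have hTu : T u = u := Submodule.reflection_mem_subspace_eq_self
    (Submodule.mem_orthogonal_singleton_iff_inner_left.2 hv)
  have key {Q : E ≃ₗᵢ[ℝ] E} (hQ : isometryDet E Q = 1) (hQu : Q u = u) : T * Q * T = Q⁻¹ := by
    have := mul_self_eq_one_of_det_eq_neg_one hE (φ := Q * T) (by simp [hQ, hT]) hu0
      (by simp [hTu, hQu])
    rw [eq_inv_iff_mul_eq_one, ← mul_eq_one_comm]
    simpa [mul_assoc] using this
  have hTT : T * T = 1 := Submodule.reflection_mul_reflection _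
  have h₁ := key (Q := R * S) (by simp [hR, hS]) (by simp [hRu, hSu])
  have h₂ : T * (R * S) * T = (T * R * T) * (T * S * T) := by
    simp only [mul_assoc]
    rw [← mul_assoc T T, hTT, one_mul]
  rw [h₂, key hR hRu, key hS hSu, ← mul_inv_rev, inv_inj] at h₁
  exact h₁.symm

theorem exists_smul_of_fixed (hE : finrank ℝ E = 3)
    {φ : E ≃ₗᵢ[ℝ] E} (hd : isometryDet E φ = 1) (hφ : φ ≠ 1) {u v : E}
    (hu0 : u ≠ 0) (hu : φ u = u) (hv : φ v = v) : ∃ a : ℝ, a • u = v := by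
  by_contra! h
  exact hφ (eq_one_of_fixed_pair hE hd ((LinearIndependent.pair_iff' hu0).2 h) hu hv)

theorem inner_axis_mul_ne_zero (hE : finrank ℝ E = 3) {R S : E ≃ₗᵢ[ℝ] E} (hR : isometryDet E R = 1)
    (hS : isometryDet E S = 1) (hR1 : R ≠ 1) (hS1 : S ≠ 1) {u v w : E}
    (huv : LinearIndependent ℝ ![u, v]) (hu : R u = u) (hv : S v = v) (hw0 : w ≠ 0)
    (hw : R (S w) = w) : inner ℝ w (S w - w) ≠ 0 := by
  intro h
  have hSw : S w = w := by
    rw [← sub_eq_zero, ← inner_self_eq_zero (𝕜 := ℝ)]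
    rw [inner_sub_right, real_inner_self_eq_norm_sq] at h
    rw [inner_sub_left, inner_sub_right, inner_sub_right, S.inner_map_map,
      real_inner_comm w (S w), real_inner_self_eq_norm_sq]
    linarith
  rw [hSw] at hw
  obtain ⟨a, ha⟩ := exists_smul_of_fixed hE hR hR1 (huv.ne_zero 0) hu hw
  obtain ⟨b, hb⟩ := exists_smul_of_fixed hE hS hS1 (huv.ne_zero 1) hv hSw
  simp only [Matrix.cons_val_zero, Matrix.cons_val_one] at ha hb
  have := (LinearIndependent.pair_iff.1 huv a (-b) (by rw [neg_smul, ha, hb, add_neg_cancel])).1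
  rw [this, zero_smul] at ha
  exact hw0 ha.symm

theorem linearIndependent_axes (hE : finrank ℝ E = 3) {R S : E ≃ₗᵢ[ℝ] E} (hR : isometryDet E R = 1)
    (hS : isometryDet E S = 1) (hR1 : R ≠ 1) (hS1 : S ≠ 1) {u v w : E}
    (huv : LinearIndependent ℝ ![u, v]) (hu : R u = u) (hv : S v = v) (hw0 : w ≠ 0)
    (hw : R (S w) = w) : LinearIndependent ℝ ![u, v, w] := by
  have hne := inner_axis_mul_ne_zero hE hR hS hR1 hS1 huv hu hv hw0 hw
  obtain ⟨h₁, h₂⟩ := inner_axis_eq_zero hu hv hw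
  rw [Fintype.linearIndependent_iff]
  intro c hc
  simp only [Fin.sum_univ_three, Matrix.cons_val_zero, Matrix.cons_val_one, Matrix.cons_val] at hc
  have h₃ := congrArg (fun x => inner ℝ x (S w - w)) hc
  simp only [inner_add_left, real_inner_smul_left, h₁, h₂, mul_zero, zero_add, inner_zero_left,
    mul_eq_zero, hne, or_false] at h₃
  rw [h₃, zero_smul, add_zero] at hc
  obtain ⟨h₄, h₅⟩ := LinearIndependent.pair_iff.1 huv _ _ hc
  intro i
  fin_cases i
  exacts [h₄, h₅, h₃]

theorem exists_common_fixed_of_independent_axes (hE : finrank ℝ E = 3) {g h : E ≃ᵢ E}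
    (hg : isometryDet E (linearPart E g) = 1) (hh : isometryDet E (linearPart E h) = 1)
    (hg1 : linearPart E g ≠ 1) (hh1 : linearPart E h ≠ 1) {u v : E}
    (huv : LinearIndependent ℝ ![u, v]) (hu : linearPart E g u = u) (hv : linearPart E h v = v)
    {x y z : E} (hx : g x = x) (hy : h y = y) (hz : g (h z) = z) : ∃ p, g p = p ∧ h p = p := by
  set R := linearPart E g
  set S := linearPart E h
  obtain ⟨w, hw0, hw⟩ := exists_axis hE (φ := R * S) (by simp [hg, hh])
  rw [LinearIsometryEquiv.coe_mul, Function.comp_apply] at hw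
  have hne := inner_axis_mul_ne_zero hE hg hh hg1 hh1 huv hu hv hw0 hw
  obtain ⟨h₁, h₂⟩ := inner_axis_eq_zero hu hv hw
  have hli := linearIndependent_axes hE hg hh hg1 hh1 huv hu hv hw0 hw
  let b := basisOfLinearIndependentOfCardEqFinrank hli (by simp [hE])
  have hb := b.sum_repr (y - x)
  set c := b.repr (y - x)
  simp only [b, Fin.sum_univ_three, coe_basisOfLinearIndependentOfCardEqFinrank,
    Matrix.cons_val_zero, Matrix.cons_val_one, Matrix.cons_val] at hb
  have horth : inner ℝ (y - x) (S w - w) = 0 := by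
    have e₁ : S (z - y) = h z - y := by rw [linearPart_sub, hy]
    have e₂ : R (h z - x) = z - x := by rw [linearPart_sub, hx, hz]
    have e₃ := R.inner_map_map (h z - x) (S w)
    have e₄ := S.inner_map_map (z - y) w
    rw [e₂, hw] at e₃
    rw [e₁] at e₄
    simp only [inner_sub_left, inner_sub_right] at e₃ e₄ ⊢
    linarith
  rw [← hb] at horth
  simp only [inner_add_left, real_inner_smul_left, h₁, h₂, mul_zero, zero_add,
    mul_eq_zero, hne, or_false] at horth
  rw [horth, zero_smul, add_zero] at hb
  refine ⟨x + c 0 • u, fixed_add_of_linearPart hx (by rw [map_smul, hu]), ?_⟩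
  have : x + c 0 • u = y + (-c 1) • v := by
    rw [neg_smul, ← sub_eq_add_neg, eq_sub_iff_add_eq, add_assoc, hb, add_sub_cancel]
  rw [this]
  exact fixed_add_of_linearPart hy (by rw [map_smul, hv])

theorem fixed_of_common_axis (hE : finrank ℝ E = 3) {g h : E ≃ᵢ E}
    (hg : isometryDet E (linearPart E g) = 1) (hh : isometryDet E (linearPart E h) = 1)
    (hg1 : linearPart E g ≠ 1) {u : E} (hu0 : u ≠ 0) (hgu : linearPart E g u = u)
    (hhu : linearPart E h u = u) {x y z : E} (hx : g x = x) (hy : h y = y)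
    (hz : (g * h * (h * g)⁻¹) z = z) : h x = x := by
  have hcomm : g * h = h * g := by
    rw [← mul_inv_eq_one]
    refine eq_one_of_linearPart_eq_one ?_ hz
    rw [map_mul, map_inv, map_mul, map_mul, commute_of_common_axis hE hg hh hu0 hgu hhu,
      mul_inv_cancel]
  have hgh : g (h x) = h x := by
    have := DFunLike.congr_fun hcomm x
    rwa [IsometryEquiv.mul_apply, IsometryEquiv.mul_apply, hx] at this
  obtain ⟨a, ha⟩ := exists_smul_of_fixed hE hg hg1 hu0 hgu (linearPart_sub_of_fixed hgh hx)
  have hinner : inner ℝ u (h x - x) = 0 := by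
    have e₁ : linearPart E h (x - y) = h x - y := by rw [linearPart_sub, hy]
    have e₂ := (linearPart E h).inner_map_map u (x - y)
    rw [e₁, hhu] at e₂
    simp only [inner_sub_right] at e₂ ⊢
    linarith
  rw [← ha, real_inner_smul_right, mul_eq_zero, inner_self_eq_zero, or_iff_left hu0] at hinner
  rw [hinner, zero_smul] at ha
  exact sub_eq_zero.1 ha.symm

theorem exists_common_fixed_pair (hE : finrank ℝ E = 3) {H : Subgroup (E ≃ᵢ E)}
    (hdet : ∀ g ∈ H, isometryDet E (linearPart E g) = 1) (hfix : ∀ g ∈ H, ∃ x, g x = x)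
    {g h : E ≃ᵢ E} (hg : g ∈ H) (hh : h ∈ H) : ∃ p, g p = p ∧ h p = p := by
  obtain ⟨x, hx⟩ := hfix g hg
  obtain ⟨y, hy⟩ := hfix h hh
  by_cases hg1 : linearPart E g = 1
  · exact ⟨y, by simp [eq_one_of_linearPart_eq_one hg1 hx], hy⟩
  by_cases hh1 : linearPart E h = 1
  · exact ⟨x, hx, by simp [eq_one_of_linearPart_eq_one hh1 hy]⟩
  obtain ⟨u, hu0, hu⟩ := exists_axis hE (hdet g hg)
  obtain ⟨v, hv0, hv⟩ := exists_axis hE (hdet h hh)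
  by_cases huv : LinearIndependent ℝ ![u, v]
  · obtain ⟨z, hz⟩ := hfix _ (H.mul_mem hg hh)
    exact exists_common_fixed_of_independent_axes hE (hdet g hg) (hdet h hh) hg1 hh1 huv hu hv
      hx hy hz
  · rw [LinearIndependent.pair_iff' hu0] at huv
    push Not at huv
    obtain ⟨a, rfl⟩ := huv
    have ha : a ≠ 0 := by rintro rfl; simp at hv0
    rw [map_smul] at hv
    obtain ⟨z, hz⟩ := hfix _ (H.mul_mem (H.mul_mem hg hh) (H.inv_mem (H.mul_mem hh hg)))
    exact ⟨x, hx, fixed_of_common_axis hE (hdet g hg) (hdet h hh) hg1 hu0 hu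
      (smul_right_injective E ha hv) hx hy hz⟩

theorem exists_common_fixed_of_det_eq_one (hE : finrank ℝ E = 3) {H : Subgroup (E ≃ᵢ E)}
    (hdet : ∀ g ∈ H, isometryDet E (linearPart E g) = 1) (hfix : ∀ g ∈ H, ∃ x, g x = x) :
    ∃ x, ∀ g ∈ H, g x = x := by
  by_cases htriv : ∀ g ∈ H, linearPart E g = 1
  · refine ⟨0, fun g hg => ?_⟩
    obtain ⟨x, hx⟩ := hfix g hg
    simp [eq_one_of_linearPart_eq_one (htriv g hg) hx]
  push Not at htriv
  obtain ⟨g, hg, hg1⟩ := htriv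
  obtain ⟨u, hu0, hu⟩ := exists_axis hE (hdet g hg)
  by_cases hpar : ∀ h ∈ H, linearPart E h u = u
  · obtain ⟨x, hx⟩ := hfix g hg
    refine ⟨x, fun h hh => ?_⟩
    obtain ⟨y, hy⟩ := hfix h hh
    obtain ⟨z, hz⟩ := hfix _ (H.mul_mem (H.mul_mem hg hh) (H.inv_mem (H.mul_mem hh hg)))
    exact fixed_of_common_axis hE (hdet g hg) (hdet h hh) hg1 hu0 hu (hpar h hh) hx hy hz
  push Not at hpar
  obtain ⟨h, hh, hhu⟩ := hpar
  have hh1 : linearPart E h ≠ 1 := fun h₀ => hhu (by simp [h₀])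
  obtain ⟨v, hv0, hv⟩ := exists_axis hE (hdet h hh)
  have huv : LinearIndependent ℝ ![u, v] := by
    rw [LinearIndependent.pair_iff' hu0]
    rintro a rfl
    have ha : a ≠ 0 := by rintro rfl; simp at hv0
    rw [map_smul] at hv
    exact hhu (smul_right_injective E ha hv)
  have hgh := H.mul_mem hg hh
  obtain ⟨w, hw0, hw⟩ := exists_axis hE (hdet _ hgh)
  have hw' : linearPart E g (linearPart E h w) = w := by
    rwa [map_mul, LinearIsometryEquiv.coe_mul, Function.comp_apply] at hw
  have hgh1 : linearPart E (g * h) ≠ 1 := by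
    intro h₀
    rw [map_mul, mul_eq_one_iff_eq_inv'] at h₀
    refine hhu ?_
    rw [h₀]
    conv_lhs => rw [← hu]
    exact (linearPart E g).symm_apply_apply u
  have hli := linearIndependent_axes hE (hdet g hg) (hdet h hh) hg1 hh1 huv hu hv hw0 hw'
  obtain ⟨p, hgp, hhp⟩ := exists_common_fixed_pair hE hdet hfix hg hh
  have hghp : (g * h) p = p := by rw [IsometryEquiv.mul_apply, hhp, hgp]
  refine ⟨p, fun k hk => ?_⟩
  by_contra hkp
  have point {f : E ≃ᵢ E} (hf : f ∈ H) (hf1 : linearPart E f ≠ 1) (hfp : f p = p) {e : E}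
      (he0 : e ≠ 0) (he : linearPart E f e = e) : ∃ a : ℝ, a ≠ 0 ∧ k (p + a • e) = p + a • e := by
    obtain ⟨q, hkq, hfq⟩ := exists_common_fixed_pair hE hdet hfix hk hf
    obtain ⟨a, ha⟩ := exists_smul_of_fixed hE (hdet f hf) hf1 he0 he
      (linearPart_sub_of_fixed hfq hfp)
    refine ⟨a, ?_, by rwa [ha, add_sub_cancel]⟩
    rintro rfl
    rw [zero_smul, eq_comm, sub_eq_zero] at ha
    exact hkp (ha ▸ hkq)
  obtain ⟨a, ha, hka⟩ := point hg hg1 hgp hu0 hu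
  obtain ⟨b, hb, hkb⟩ := point hh hh1 hhp hv0 hv
  obtain ⟨c, hc, hkc⟩ := point hgh hgh1 hghp hw0 hw
  have hpair : LinearIndependent ℝ ![(p + a • u) - (p + b • v), (p + a • u) - (p + c • w)] := by
    rw [LinearIndependent.pair_iff]
    intro s t hst
    have hsum : ∑ i, ![(s + t) * a, -(s * b), -(t * c)] i • ![u, v, w] i = 0 := by
      simp only [Fin.sum_univ_three, Matrix.cons_val_zero, Matrix.cons_val_one, Matrix.cons_val]
      rw [← hst]
      module
    have hz := Fintype.linearIndependent_iff.1 hli _ hsum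
    have h₁ := hz 1
    have h₂ := hz 2
    simp only [Matrix.cons_val_one, Matrix.cons_val, neg_eq_zero, mul_eq_zero, hb, hc, or_false,
      Matrix.cons_val_zero] at h₁ h₂
    exact ⟨h₁, h₂⟩
  have hk1 := eq_one_of_fixed_pair hE (hdet k hk) hpair (linearPart_sub_of_fixed hka hkb)
    (linearPart_sub_of_fixed hka hkc)
  exact hkp (by simp [eq_one_of_linearPart_eq_one hk1 hka])

theorem isometryFixating_of_finrank_eq_three (hE : finrank ℝ E = 3) : IsometryFixating E := by
  intro G hG
  let δ : (E ≃ᵢ E) →* ℝ := (isometryDet E).comp (linearPart E)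
  obtain ⟨x, hx⟩ := exists_common_fixed_of_det_eq_one hE (H := G ⊓ δ.ker) (fun g hg => hg.2)
    fun g hg => hG g hg.1
  by_cases hker : ∀ g ∈ G, δ g = 1
  · exact ⟨x, fun g hg => hx g ⟨hg, hker g hg⟩⟩
  push Not at hker
  obtain ⟨g, hg, hg1⟩ := hker
  have hneg : ∀ {f}, δ f ≠ 1 → δ f = -1 := fun {f} hf =>
    (isometryDet_eq_or (linearPart E f)).resolve_left hf
  have hmul {f k : E ≃ᵢ E} (hf : δ f ≠ 1) (hk : δ k ≠ 1) : f * k ∈ δ.ker := by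
    rw [MonoidHom.mem_ker, map_mul, hneg hf, hneg hk, neg_mul_neg, one_mul]
  have hinv : δ g⁻¹ ≠ 1 := fun h => hg1 (by
    have := map_mul δ g g⁻¹
    rwa [mul_inv_cancel, map_one, h, mul_one, eq_comm] at this)
  have hgx {k : E ≃ᵢ E} (hk : k ∈ G ⊓ δ.ker) : k (g x) = g x := by
    have := hx (g⁻¹ * k * g) ⟨G.mul_mem (G.mul_mem (G.inv_mem hg) hk.1) hg,
      MonoidHom.mem_ker.2 <| by
      rw [map_mul, map_mul, MonoidHom.mem_ker.1 hk.2, mul_one, ← map_mul,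
        inv_mul_cancel, map_one]⟩
    rw [IsometryEquiv.mul_apply, IsometryEquiv.mul_apply] at this
    exact (IsometryEquiv.symm_apply_eq g).1 this
  have hmid {k : E ≃ᵢ E} (hk : k ∈ G ⊓ δ.ker) : k (midpoint ℝ x (g x)) = midpoint ℝ x (g x) := by
    rw [IsometryEquiv.map_midpoint, hx k hk, hgx hk]
  have hgmid : g (midpoint ℝ x (g x)) = midpoint ℝ x (g x) := by
    have : g (g x) = x := hx (g * g) ⟨G.mul_mem hg hg, hmul hg1 hg1⟩
    rw [IsometryEquiv.map_midpoint, this, midpoint_comm]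
  refine ⟨midpoint ℝ x (g x), fun k hk => ?_⟩
  by_cases hk1 : δ k = 1
  · exact hmid ⟨hk, hk1⟩
  · have := hmid (k := g⁻¹ * k) ⟨G.mul_mem (G.inv_mem hg) hk, hmul hinv hk1⟩
    rw [IsometryEquiv.mul_apply] at this
    rw [(IsometryEquiv.symm_apply_eq g).1 this, hgmid]

end Rotations

/-- The isometry group of the Euclidean space `ℝⁿ` (`n ≥ 1`) is fixating
(every subgroup consisting of isometries in which each element has a fixed
point has a common fixed point) if and only if `n ≤ 3`. -/
theorem isom_euclidean_fixating_iff_dim_le_three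
    (n : ℕ) (hn : 1 ≤ n) :
    (∀ G : Subgroup (Equiv.Perm (EuclideanSpace ℝ (Fin n))),
      (∀ g ∈ G, ∀ x y : EuclideanSpace ℝ (Fin n), dist (g x) (g y) = dist x y) →
      (∀ g ∈ G, ∃ x : EuclideanSpace ℝ (Fin n), g x = x) →
      ∃ x : EuclideanSpace ℝ (Fin n), ∀ g ∈ G, g x = x) ↔ n ≤ 3 := by
  rw [← isometryFixating_iff_perm]
  constructor
  · intro h
    by_contra! hn4
    refine not_isometryFixating_quaternion (h.of_finrank_le ?_)
    rw [Quaternion.finrank_eq_four, finrank_euclideanSpace_fin]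
    omega
  · intro hn3
    refine (isometryFixating_of_finrank_eq_three (E := EuclideanSpace ℝ (Fin 3))
      finrank_euclideanSpace_fin).of_finrank_le ?_
    rwa [finrank_euclideanSpace_fin, finrank_euclideanSpace_fin]
end

section
/- The isometry group of the hyperbolic plane is fixating: every subgroup of the group of surjective self-isometries of the upper half-plane ℍ₂ = {z ∈ ℂ : Im z > 0}, equipped with the hyperbolic (Poincaré) metric, that is a GAF is a GAG. -/
open Matrix
open scoped MatrixGroups

namespace UpperHalfPlane

/-- Every element of `GL(2, ℝ)` acts on the upper half-plane by an isometry. -/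
theorem dist_gl_smul (g : GL (Fin 2) ℝ) (z w : ℍ) : dist (g • z) (g • w) = dist z w := by
  have hz := denom_ne_zero g z
  have hw := denom_ne_zero g w
  have hdet : g.det.val ≠ 0 := g.det.ne_zero
  have hnum : num g z / denom g z - num g w / denom g w =
      (g.det.val : ℂ) * (z - w) / (denom g z * denom g w) := by
    rw [div_sub_div _ _ hz hw]
    congr 1
    simp [num, denom, Matrix.det_fin_two]
    ring
  have hcosh : Real.cosh (dist (g • z) (g • w)) = Real.cosh (dist z w) := by
    rw [cosh_dist, cosh_dist, dist_eq_norm, dist_eq_norm, coe_smul, coe_smul, ← map_sub, norm_σ,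
      hnum, im_smul_eq_div_normSq, im_smul_eq_div_normSq, Complex.normSq_eq_norm_sq,
      Complex.normSq_eq_norm_sq, norm_div, norm_mul, norm_mul, Complex.norm_real, Real.norm_eq_abs]
    have h₁ := norm_ne_zero_iff.2 hz
    have h₂ := norm_ne_zero_iff.2 hw
    have h₃ := abs_ne_zero.2 hdet
    have h₄ := z.im_ne_zero
    have h₅ := w.im_ne_zero
    field_simp
  exact Real.cosh_strictMonoOn.injOn dist_nonneg dist_nonneg hcosh

/-- The point `2i` of the upper half-plane. -/
def twoI : ℍ := ⟨⟨0, 2⟩, two_pos⟩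

/-- The point `1 + i` of the upper half-plane. -/
def oneAddI : ℍ := ⟨⟨1, 1⟩, one_pos⟩

@[simp] theorem twoI_re : twoI.re = 0 := rfl

@[simp] theorem twoI_im : twoI.im = 2 := rfl

@[simp] theorem oneAddI_re : oneAddI.re = 1 := rfl

@[simp] theorem oneAddI_im : oneAddI.im = 1 := rfl

/-- Points at the same distance from `p` satisfy a quadratic equation in coordinates. -/
theorem mul_eq_mul_of_dist_eq {z w p : ℍ} (h : dist z p = dist w p) :
    ((z.re - p.re) ^ 2 + z.im ^ 2 + p.im ^ 2) * w.im =
      ((w.re - p.re) ^ 2 + w.im ^ 2 + p.im ^ 2) * z.im := by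
  have hcosh := congrArg Real.cosh h
  have h₁ := z.im_ne_zero
  have h₂ := w.im_ne_zero
  have h₃ := p.im_ne_zero
  rw [cosh_dist', cosh_dist'] at hcosh
  field_simp at hcosh
  linarith

/-- The distances to `i` and `2i` determine a point up to the reflection in the imaginary axis. -/
theorem im_eq_and_sq_re_eq_of_dist_eq {z w : ℍ} (h₁ : dist z I = dist w I)
    (h₂ : dist z twoI = dist w twoI) : z.im = w.im ∧ z.re ^ 2 = w.re ^ 2 := by
  have e₁ := mul_eq_mul_of_dist_eq h₁
  have e₂ := mul_eq_mul_of_dist_eq h₂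
  simp only [I_re, I_im, twoI_re, twoI_im] at e₁ e₂
  have him : z.im = w.im := by linarith
  rw [him] at e₁
  have := mul_right_cancel₀ w.im_ne_zero e₁
  exact ⟨him, by linarith⟩

/-- The distances to `i`, `2i` and `1 + i` determine a point of the upper half-plane. -/
theorem eq_of_dist_eq {z w : ℍ} (h₁ : dist z I = dist w I)
    (h₂ : dist z twoI = dist w twoI) (h₃ : dist z oneAddI = dist w oneAddI) : z = w := by
  obtain ⟨him, hre⟩ := im_eq_and_sq_re_eq_of_dist_eq h₁ h₂
  have e₃ := mul_eq_mul_of_dist_eq h₃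
  simp only [oneAddI_re, oneAddI_im] at e₃
  rw [him] at e₃
  have := mul_right_cancel₀ w.im_ne_zero e₃
  exact ext_re_im (by linarith) him

/-- The stabilizer of `i` acts transitively on the hyperbolic circle centred at `i`
passing through `2i`. -/
theorem exists_gl_smul_I_eq_and_smul_eq_twoI {w : ℍ} (h : dist w I = dist twoI I) :
    ∃ g : GL (Fin 2) ℝ, g • I = I ∧ g • w = twoI := by
  have e := mul_eq_mul_of_dist_eq h
  simp only [I_re, I_im, twoI_re, twoI_im] at e
  obtain ⟨a, b, hab, h₁, h₂⟩ : ∃ a b : ℝ, 0 < a ^ 2 + b ^ 2 ∧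
      a * w.re = b * (2 * w.im - 1) ∧ a * (w.im - 2) = -2 * b * w.re := by
    by_cases hw : w.re = 0 ∧ 2 * w.im - 1 = 0
    · exact ⟨0, 1, by norm_num, by simp [hw.2], by simp [hw.1]⟩
    · refine ⟨2 * w.im - 1, w.re, ?_, by ring, by linarith⟩
      rcases not_and_or.1 hw with hw | hw <;> positivity
  have hdet : (!![a, b; -b, a] : Matrix (Fin 2) (Fin 2) ℝ).det = a ^ 2 + b ^ 2 := by
    simp [Matrix.det_fin_two]; ring
  let g : GL (Fin 2) ℝ := .mkOfDetNeZero !![a, b; -b, a] (hdet ▸ hab.ne')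
  have hg : 0 < g.det.val := by
    change 0 < (!![a, b; -b, a] : Matrix (Fin 2) (Fin 2) ℝ).det
    rwa [hdet]
  refine ⟨g, (gl_smul_I_eq_I_iff_of_pos hg).2 ⟨rfl, (neg_neg b).symm⟩, ?_⟩
  rw [gl_smul_eq_iff_num_eq, σ, if_pos hg]
  have htwoI : (twoI : ℂ) = ⟨0, 2⟩ := rfl
  simp [g, num, denom, Complex.ext_iff, htwoI, Matrix.GeneralLinearGroup.mkOfDetNeZero]
  constructor <;> linarith

/-- Every isometry of the upper half-plane is given by an element of `GL(2, ℝ)`. -/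
theorem exists_gl_smul_eq_of_dist_eq {f : ℍ → ℍ} (hf : ∀ x y, dist (f x) (f y) = dist x y) :
    ∃ g : GL (Fin 2) ℝ, ∀ z, f z = g • z := by
  obtain ⟨g₁, hg₁⟩ := MulAction.exists_smul_eq (GL (Fin 2) ℝ) (f I) I
  have hdist : dist (g₁ • f twoI) I = dist twoI I := by
    conv_lhs => rw [← hg₁]
    rw [dist_gl_smul, hf]
  obtain ⟨g₂, hI, htwoI⟩ := exists_gl_smul_I_eq_and_smul_eq_twoI hdist
  -- an isometry fixing three points in general position is the identity
  have key : ∀ g : GL (Fin 2) ℝ, g • f I = I → g • f twoI = twoI → g • f oneAddI = oneAddI →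
      ∃ g : GL (Fin 2) ℝ, ∀ z, f z = g • z := by
    intro g h₁ h₂ h₃
    have hd (z p : ℍ) (hp : g • f p = p) : dist (g • f z) p = dist z p := by
      conv_lhs => rw [← hp]
      rw [dist_gl_smul, hf]
    exact ⟨g⁻¹, fun z ↦ eq_inv_smul_iff.2 <|
      eq_of_dist_eq (hd z _ h₁) (hd z _ h₂) (hd z _ h₃)⟩
  set g := g₂ * g₁ with hg
  have h₁ : g • f I = I := by rw [hg, mul_smul, hg₁, hI]
  have h₂ : g • f twoI = twoI := by rw [hg, mul_smul, htwoI]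
  have hd (p : ℍ) (hp : g • f p = p) : dist (g • f oneAddI) p = dist oneAddI p := by
    conv_lhs => rw [← hp]
    rw [dist_gl_smul, hf]
  obtain ⟨him, hre⟩ := im_eq_and_sq_re_eq_of_dist_eq (hd _ h₁) (hd _ h₂)
  have hJ (z : ℍ) : (J • z).re = -z.re ∧ (J • z).im = z.im := by
    rw [← coe_re, ← coe_im, coe_J_smul]
    simp
  rcases sq_eq_sq_iff_eq_or_eq_neg.1 hre with hre | hre
  · exact key g h₁ h₂ (ext_re_im hre him)
  · refine key (J * g) ?_ ?_ ?_ <;> rw [mul_smul]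
    · rw [h₁]; exact ext_re_im (by simp [hJ]) (hJ _).2
    · rw [h₂]; exact ext_re_im (by simp [hJ]) (hJ _).2
    · exact ext_re_im (by rw [(hJ _).1, hre, neg_neg]) ((hJ _).2.trans him)

/-- The commutator `A * B - B * A` with an elliptic matrix `A` has nonpositive determinant, and
it vanishes if its determinant does. -/
theorem det_commutator_nonpos {A B : Matrix (Fin 2) (Fin 2) ℝ} (hA : A.discr < 0) :
    (A * B - B * A).det ≤ 0 ∧ ((A * B - B * A).det = 0 → A * B = B * A) := by
  set M := A * B - B * A with hM
  have hdisc : (A 0 0 - A 1 1) ^ 2 + 4 * (A 0 1 * A 1 0) < 0 := by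
    rw [Matrix.discr_fin_two, Matrix.trace_fin_two, Matrix.det_fin_two] at hA
    linarith
  have hc : A 1 0 ≠ 0 := by
    intro hc
    rw [hc] at hdisc
    nlinarith [sq_nonneg (A 0 0 - A 1 1)]
  have hsq : 0 < A 1 0 ^ 2 := by positivity
  have htr : M 1 1 = -M 0 0 := by
    simp [hM, Matrix.mul_apply, Fin.sum_univ_two]; ring
  have horth : M 0 0 * (A 0 0 - A 1 1) + M 0 1 * A 1 0 + M 1 0 * A 0 1 = 0 := by
    simp [hM, Matrix.mul_apply, Fin.sum_univ_two]; ring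
  have hdet : A 1 0 ^ 2 * -M.det = (A 1 0 * M 0 0 - (A 0 0 - A 1 1) * M 1 0 / 2) ^ 2 +
      M 1 0 ^ 2 * (-((A 0 0 - A 1 1) ^ 2 + 4 * (A 0 1 * A 1 0)) / 4) := by
    rw [Matrix.det_fin_two, htr]
    linear_combination (A 1 0 * M 1 0) * horth
  have hpos : 0 < -((A 0 0 - A 1 1) ^ 2 + 4 * (A 0 1 * A 1 0)) / 4 := by linarith
  refine ⟨?_, fun h₀ ↦ sub_eq_zero.1 ?_⟩
  · by_contra! h
    have : 0 ≤ A 1 0 ^ 2 * -M.det := by rw [hdet]; positivity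
    nlinarith [mul_pos hsq h]
  · rw [h₀, neg_zero, mul_zero, eq_comm, add_eq_zero_iff_of_nonneg (by positivity) (by positivity)]
      at hdet
    have h₁ : M 1 0 = 0 :=
      pow_eq_zero_iff two_ne_zero |>.1 ((mul_eq_zero.1 hdet.2).resolve_right hpos.ne')
    have h₂ : M 0 0 = 0 := by simpa [h₁, hc] using hdet.1
    have h₃ : M 0 1 = 0 := by simpa [h₁, h₂, hc] using horth
    rw [← hM]
    ext i j
    fin_cases i <;> fin_cases j <;> simp [h₁, h₂, h₃, htr]

/-- The trace of a group commutator in terms of the determinant of the ring commutator. -/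
theorem trace_commutator_mul_det (A B : GL (Fin 2) ℝ) :
    (A * B * A⁻¹ * B⁻¹).val.trace * (A.val.det * B.val.det) =
      2 * (A.val.det * B.val.det) - (A.val * B.val - B.val * A.val).det := by
  have hinv : (A * B * A⁻¹ * B⁻¹).val * (A.val.det * B.val.det) • (1 : Matrix (Fin 2) (Fin 2) ℝ) =
      A.val * B.val * (A.val.adjugate * B.val.adjugate) := by
    have hA : (A⁻¹).val * A.val = 1 := by simp
    have hB : (B⁻¹).val * B.val = 1 := by simp
    calc
      _ = A.val * B.val * (A⁻¹).val * (B⁻¹).val *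
          (B.val * (A.val * A.val.adjugate) * B.val.adjugate) := by
        simp [Matrix.mul_adjugate, mul_smul]
      _ = A.val * B.val * (A⁻¹).val * ((B⁻¹).val * B.val) * A.val *
          (A.val.adjugate * B.val.adjugate) := by simp only [mul_assoc]
      _ = A.val * B.val * ((A⁻¹).val * A.val) * (A.val.adjugate * B.val.adjugate) := by
        rw [hB, mul_one]; simp only [mul_assoc]
      _ = _ := by rw [hA, mul_one]
  have htr := congrArg Matrix.trace hinv
  rw [Matrix.mul_smul, mul_one, Matrix.trace_smul, smul_eq_mul, mul_comm] at htr
  rw [htr]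
  simp [Matrix.trace_fin_two, Matrix.det_fin_two, Matrix.adjugate_fin_two, Matrix.mul_apply,
    Fin.sum_univ_two]
  ring

/-- If `A` is elliptic and both `A` and `B` preserve orientation, then their group commutator has
a fixed point only if `A` and `B` commute. -/
theorem commute_of_commutator_smul_eq {A B : GL (Fin 2) ℝ} (hA : 0 < A.val.det)
    (hB : 0 < B.val.det) (hell : A.IsElliptic)
    (hfix : ∃ z : ℍ, (A * B * A⁻¹ * B⁻¹) • z = z) : Commute A B := by
  obtain ⟨hle, heq⟩ := det_commutator_nonpos (B := B.val) hell
  have htr := trace_commutator_mul_det A B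
  set C := A * B * A⁻¹ * B⁻¹ with hC
  have hAB : 0 < A.val.det * B.val.det := mul_pos hA hB
  have hdet : C.val.det = 1 := by
    have : C.det = 1 := by
      simp only [hC, map_mul, map_inv]
      rw [mul_right_comm, mul_inv_cancel_right, mul_inv_cancel]
    simpa using congrArg Units.val this
  have htwo : 2 ≤ C.val.trace := by
    refine le_of_mul_le_mul_right ?_ hAB
    linarith
  have htrace : C.val.trace ^ 2 ≤ 4 := by
    by_cases hcen : C ∈ Subgroup.center _
    · rw [GeneralLinearGroup.mem_center_iff_val_mem_range_scalar] at hcen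
      obtain ⟨u, hu⟩ := hcen
      rw [← hu] at hdet ⊢
      simp at hdet ⊢
      rcases hdet with rfl | rfl <;> norm_num
    · have h := isElliptic_of_exists_smul_eq_self (by rw [hdet]; exact one_pos) hcen hfix
      have h' : C.val.discr < 0 := h
      rw [Matrix.discr_fin_two, hdet] at h'
      linarith
  have htr₂ : C.val.trace = 2 := by nlinarith
  rw [htr₂] at htr
  exact Units.ext (heq (by linarith))

/-- A subgroup of `GL(2, ℝ)` whose elements all have fixed points in the upper half-plane has a
common fixed point. -/
theorem exists_forall_gl_smul_eq (H : Subgroup (GL (Fin 2) ℝ))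
    (hfix : ∀ A ∈ H, ∃ z : ℍ, A • z = z) : ∃ z : ℍ, ∀ A ∈ H, A • z = z := by
  by_cases hrot : ∃ A ∈ H, 0 < A.val.det ∧ A ∉ Subgroup.center _
  · obtain ⟨A, hAH, hA, hcen⟩ := hrot
    have hell := isElliptic_of_exists_smul_eq_self hA hcen (hfix A hAH)
    have huniq (z : ℍ) := gl_smul_eq_self_iff_eq_fixedPt (z := z) hA hell
    refine ⟨fixedPt A hell, fun D hD ↦ ?_⟩
    set p := fixedPt A hell
    have hp : A • p = p := (huniq p).2 rfl
    set B := D * A * D⁻¹ with hBdef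
    have hBH : B ∈ H := H.mul_mem (H.mul_mem hD hAH) (H.inv_mem hD)
    have hB : 0 < B.val.det := by
      have : B.det = A.det := by simp [hBdef]
      have := congrArg Units.val this
      simp only [GeneralLinearGroup.val_det_apply] at this
      rwa [this]
    have hcomm := commute_of_commutator_smul_eq hA hB hell <| hfix _ <|
      H.mul_mem (H.mul_mem (H.mul_mem hAH hBH) (H.inv_mem hAH)) (H.inv_mem hBH)
    have hBp : B • D • p = D • p := by
      rw [hBdef, mul_smul, mul_smul, inv_smul_smul, hp]
    have hBAp : B • A • D • p = A • D • p := by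
      rw [← mul_smul, ← hcomm.eq, mul_smul, hBp]
    rw [hBdef, mul_smul, mul_smul, ← eq_inv_smul_iff, huniq, inv_smul_eq_iff] at hBAp
    exact (huniq _).1 hBAp
  · push Not at hrot
    have htriv (A) (hA : A ∈ H) (hpos : 0 < A.val.det) (z : ℍ) : A • z = z :=
      forall_smul_eq_self_iff_mem_center.2 (hrot A hA hpos) z
    by_cases href : ∃ A ∈ H, A.val.det < 0
    · obtain ⟨A, hAH, hA⟩ := href
      obtain ⟨z, hz⟩ := hfix A hAH
      refine ⟨z, fun D hD ↦ ?_⟩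
      rcases D.det_ne_zero.lt_or_gt with hneg | hpos
      · have h := htriv (D * A) (H.mul_mem hD hAH)
          (by rw [Units.val_mul, Matrix.det_mul]; exact mul_pos_of_neg_of_neg hneg hA) z
        rwa [mul_smul, hz] at h
      · exact htriv D hD hpos z
    · push Not at href
      exact ⟨I, fun D hD ↦ htriv D hD ((href D hD).lt_of_ne' D.det_ne_zero) I⟩

end UpperHalfPlane

/-- The isometry group of the hyperbolic plane (the upper half-plane with the
Poincaré metric) is fixating: every subgroup of the permutation group of the
upper half-plane consisting of isometries for the hyperbolic distance, each
element of which has a fixed point, has a common fixed point. -/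
theorem isom_hyperbolic_plane_fixating
    (G : Subgroup (Equiv.Perm UpperHalfPlane))
    (hiso : ∀ g ∈ G, ∀ x y : UpperHalfPlane, dist (g x) (g y) = dist x y)
    (hGAF : ∀ g ∈ G, ∃ x : UpperHalfPlane, g x = x) :
    ∃ x : UpperHalfPlane, ∀ g ∈ G, g x = x := by
  obtain ⟨x, hx⟩ := UpperHalfPlane.exists_forall_gl_smul_eq
    (G.comap (MulAction.toPermHom (GL (Fin 2) ℝ) UpperHalfPlane))
    fun A hA ↦ hGAF _ hA
  refine ⟨x, fun g hg ↦ ?_⟩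
  obtain ⟨A, hA⟩ := UpperHalfPlane.exists_gl_smul_eq_of_dist_eq (hiso g hg)
  have hAg : MulAction.toPermHom (GL (Fin 2) ℝ) UpperHalfPlane A = g :=
    Equiv.ext fun z ↦ (hA z).symm
  rw [hA]
  exact hx A (by rwa [Subgroup.mem_comap, hAg])
end
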